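/- (Identity (A.4), combined energy–mass expansion) Let c > 0, a ∈ ℝ, and let Q̃_c(s) = (3c/2) · sech²(√c·s/2). Let z : [0,∞) → ℝ be continuously differentiable, bounded, with z(x) → 0 as x → +∞, with z and z' square integrable and z³ integrable on (0,∞), and with z(0) = −Q̃_c(−a). Define u(x) = Q̃_c(x−a) + z(x) for x ≥ 0 (so u(0) = 0), and for a function v on (0,∞) set M[v] = (1/2)∫₀^∞ v² dx and E[v] = ∫₀^∞ ( (1/2)(v')² − (1/3)v³ ) dx. Then E[u] + c·M[u] − ( E[Q̃_c(·−a)] + c·M[Q̃_c(·−a)] ) = −Q̃_c(a)·Q̃_c'(a) + (c/2)∫₀^∞ z² dx + (1/2)∫₀^∞ (z')² dx − ∫₀^∞ Q̃_c(x−a)·z² dx − (1/3)∫₀^∞ z³ dx. -/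

import Mathlib

open MeasureTheory Set Filter

/-- The KdV soliton profile `Q̃_c(s) = (3c/2) sech²(√c s / 2)`. -/
noncomputable def Qsol (c s : ℝ) : ℝ :=
  (3 * c / 2) * (1 / Real.cosh (Real.sqrt c * s / 2)) ^ 2

/-- Explicit derivative of the profile. -/
noncomputable def Qsold (c s : ℝ) : ℝ :=
  -(Real.sqrt c) * (Real.sinh (Real.sqrt c * s / 2) / Real.cosh (Real.sqrt c * s / 2)) * Qsol c s

lemma Qsol_hasDerivAt (c s : ℝ) : HasDerivAt (Qsol c) (Qsold c s) s := by
  have hy : HasDerivAt (fun s : ℝ => Real.sqrt c * s / 2) (Real.sqrt c / 2) s := by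
    simpa using ((hasDerivAt_id s).const_mul (Real.sqrt c)).div_const 2
  have hpos := Real.cosh_pos (Real.sqrt c * s / 2)
  have h := (((hasDerivAt_const s (1 : ℝ)).div hy.cosh hpos.ne').pow 2).const_mul (3 * c / 2)
  refine h.congr_deriv ?_
  simp only [Qsold, Qsol, Pi.div_apply, show (2 - 1 : ℕ) = 1 from rfl, pow_one, Nat.cast_ofNat]
  generalize Real.cosh (Real.sqrt c * s / 2) = C at *
  generalize Real.sinh (Real.sqrt c * s / 2) = S at *
  field_simp
  try ring

lemma Qsold_hasDerivAt (c : ℝ) (hc : 0 < c) (s : ℝ) :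
    HasDerivAt (Qsold c) (c * Qsol c s - Qsol c s ^ 2) s := by
  have hy : HasDerivAt (fun s : ℝ => Real.sqrt c * s / 2) (Real.sqrt c / 2) s := by
    simpa using ((hasDerivAt_id s).const_mul (Real.sqrt c)).div_const 2
  have hpos := Real.cosh_pos (Real.sqrt c * s / 2)
  have h := ((hy.sinh.div hy.cosh hpos.ne').const_mul (-(Real.sqrt c))).mul (Qsol_hasDerivAt c s)
  refine h.congr_deriv ?_
  have hs : Real.sqrt c ^ 2 = c := Real.sq_sqrt hc.le
  have hch := Real.cosh_sq (Real.sqrt c * s / 2)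
  simp only [Qsold, Qsol, Pi.div_apply]
  generalize Real.cosh (Real.sqrt c * s / 2) = C at *
  generalize Real.sinh (Real.sqrt c * s / 2) = S at *
  generalize Real.sqrt c = r at *
  have hS : S ^ 2 = C ^ 2 - 1 := by linarith
  subst hs
  field_simp
  ring_nf
  try simp only [hS]
  try ring_nf

lemma Qsol_nonneg (c : ℝ) (hc : 0 < c) (s : ℝ) : 0 ≤ Qsol c s := by
  unfold Qsol; positivity

lemma Qsol_le (c : ℝ) (hc : 0 < c) (s : ℝ) : Qsol c s ≤ 3 * c / 2 := by
  unfold Qsol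
  have h1 := Real.one_le_cosh (Real.sqrt c * s / 2)
  have h2 : 1 / Real.cosh (Real.sqrt c * s / 2) ≤ 1 := by
    rw [div_le_one (by positivity)]; exact h1
  have h3 : (1 / Real.cosh (Real.sqrt c * s / 2)) ^ 2 ≤ 1 := pow_le_one₀ (by positivity) h2
  nlinarith

lemma Qsol_le_exp (c : ℝ) (hc : 0 < c) (s : ℝ) :
    Qsol c s ≤ 6 * c * Real.exp (-(Real.sqrt c) * s) := by
  unfold Qsol
  set y := Real.sqrt c * s / 2 with hy
  have h1 : Real.exp y / 2 ≤ Real.cosh y := by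
    rw [Real.cosh_eq]; have := Real.exp_pos (-y); linarith
  have h2 : 1 / Real.cosh y ≤ 2 * Real.exp (-y) := by
    rw [Real.exp_neg, div_le_iff₀ (Real.cosh_pos y)]
    have := Real.exp_pos y
    field_simp
    linarith
  have h3 : (1 / Real.cosh y) ^ 2 ≤ (2 * Real.exp (-y)) ^ 2 :=
    pow_le_pow_left₀ (by positivity) h2 2
  have h4 : Real.exp (-(Real.sqrt c) * s) = Real.exp (-y) ^ 2 := by
    rw [← Real.exp_nat_mul]; congr 1; rw [hy]; push_cast; ring
  rw [h4]
  nlinarith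

lemma Qsold_abs_le (c : ℝ) (hc : 0 < c) (s : ℝ) :
    |Qsold c s| ≤ Real.sqrt c * Qsol c s := by
  unfold Qsold
  have hpos := Real.cosh_pos (Real.sqrt c * s / 2)
  have h : |Real.sinh (Real.sqrt c * s / 2) / Real.cosh (Real.sqrt c * s / 2)| ≤ 1 := by
    rw [abs_div, abs_of_pos hpos, div_le_one hpos]
    apply abs_le_of_sq_le_sq _ hpos.le
    have := Real.cosh_sq (Real.sqrt c * s / 2); linarith
  rw [abs_mul, abs_mul, abs_neg, abs_of_nonneg (Real.sqrt_nonneg c),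
    abs_of_nonneg (Qsol_nonneg c hc s)]
  have := Qsol_nonneg c hc s
  have := Real.sqrt_nonneg c
  gcongr
  nlinarith

lemma Qsol_shift_integrable (c : ℝ) (hc : 0 < c) (a : ℝ) :
    IntegrableOn (fun x => Qsol c (x - a)) (Ioi 0) := by
  have hcont : Continuous (Qsol c) :=
    continuous_iff_continuousAt.2 fun s => (Qsol_hasDerivAt c s).continuousAt
  have hi : IntegrableOn
      (fun x => 6 * c * Real.exp (Real.sqrt c * a) * Real.exp (-(Real.sqrt c) * x)) (Ioi 0) :=
    (exp_neg_integrableOn_Ioi 0 (Real.sqrt_pos.2 hc)).const_mul _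
  refine Integrable.mono' hi (by fun_prop) (Eventually.of_forall fun x => ?_)
  rw [Real.norm_eq_abs, abs_of_nonneg (Qsol_nonneg c hc _)]
  refine (Qsol_le_exp c hc _).trans (le_of_eq ?_)
  rw [mul_assoc (6 * c), ← Real.exp_add]
  congr 2; ring

lemma dom_integrable {q f : ℝ → ℝ} (K : ℝ) (hq : IntegrableOn q (Ioi 0)) (hf : Continuous f)
    (h : ∀ x > 0, |f x| ≤ K * q x) : IntegrableOn f (Ioi 0) := by
  refine Integrable.mono' (hq.const_mul K) hf.aestronglyMeasurable ?_
  filter_upwards [ae_restrict_mem measurableSet_Ioi] with x hx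
  exact h x hx

theorem identity_A4_energy_mass_expansion (c : ℝ) (hc : 0 < c) (a : ℝ) (z : ℝ → ℝ)
    (hz : ContDiff ℝ 1 z) (hbdd : ∃ M : ℝ, ∀ x ≥ (0 : ℝ), |z x| ≤ M)
    (hdecay : Tendsto z atTop (nhds 0))
    (hz2 : IntegrableOn (fun x => (z x) ^ 2) (Ioi 0))
    (hz'2 : IntegrableOn (fun x => (deriv z x) ^ 2) (Ioi 0))
    (hz3 : IntegrableOn (fun x => (z x) ^ 3) (Ioi 0))
    (hz0 : z 0 = -Qsol c (-a))
    (u : ℝ → ℝ) (hu : u = fun x => Qsol c (x - a) + z x) :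
    (∫ x in Ioi (0 : ℝ), ((1 / 2) * (deriv u x) ^ 2 - (1 / 3) * (u x) ^ 3))
        + c * ((1 / 2) * ∫ x in Ioi (0 : ℝ), (u x) ^ 2)
        - ((∫ x in Ioi (0 : ℝ),
              ((1 / 2) * (deriv (Qsol c) (x - a)) ^ 2 - (1 / 3) * (Qsol c (x - a)) ^ 3))
            + c * ((1 / 2) * ∫ x in Ioi (0 : ℝ), (Qsol c (x - a)) ^ 2))
      = -(Qsol c a * deriv (Qsol c) a)
        + (c / 2) * (∫ x in Ioi (0 : ℝ), (z x) ^ 2)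
        + (1 / 2) * (∫ x in Ioi (0 : ℝ), (deriv z x) ^ 2)
        - (∫ x in Ioi (0 : ℝ), Qsol c (x - a) * (z x) ^ 2)
        - (1 / 3) * ∫ x in Ioi (0 : ℝ), (z x) ^ 3 := by
  obtain ⟨M, hM⟩ := hbdd
  have hM0 : 0 ≤ M := (abs_nonneg _).trans (hM 0 le_rfl)
  have hdQ : deriv (Qsol c) = Qsold c := funext fun s => (Qsol_hasDerivAt c s).deriv
  have hQc : Continuous (Qsol c) :=
    continuous_iff_continuousAt.2 fun s => (Qsol_hasDerivAt c s).continuousAt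
  have hPc : Continuous (Qsold c) :=
    continuous_iff_continuousAt.2 fun s => (Qsold_hasDerivAt c hc s).continuousAt
  have hzc : Continuous z := hz.continuous
  have hz'c : Continuous (deriv z) := hz.continuous_deriv (le_refl _)
  have hzd : ∀ x, HasDerivAt z (deriv z x) x := fun x =>
    (hz.differentiable (by norm_num) x).hasDerivAt
  have hqd : ∀ x, HasDerivAt (fun x => Qsol c (x - a)) (Qsold c (x - a)) x := fun x =>
    (Qsol_hasDerivAt c (x - a)).comp_sub_const x a
  have hpd : ∀ x, HasDerivAt (fun x => Qsold c (x - a))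
      (c * Qsol c (x - a) - Qsol c (x - a) ^ 2) x := fun x =>
    (Qsold_hasDerivAt c hc (x - a)).comp_sub_const x a
  have hud : ∀ x, deriv u x = Qsold c (x - a) + deriv z x := fun x => by
    rw [hu]; exact ((hqd x).add (hzd x)).deriv
  have hux : ∀ x, u x = Qsol c (x - a) + z x := fun x => by rw [hu]
  have hea : Qsol c (-a) = Qsol c a := by
    unfold Qsol
    rw [show Real.sqrt c * -a / 2 = -(Real.sqrt c * a / 2) by ring, Real.cosh_neg]
  have hoa : Qsold c (-a) = -Qsold c a := by
    unfold Qsold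
    rw [hea, show Real.sqrt c * -a / 2 = -(Real.sqrt c * a / 2) by ring, Real.cosh_neg,
      Real.sinh_neg]
    ring
  simp only [hud, hdQ, hux]
  have hq0 : ∀ x, 0 ≤ Qsol c (x - a) := fun x => Qsol_nonneg c hc _
  have hqB : ∀ x, Qsol c (x - a) ≤ 3 * c / 2 := fun x => Qsol_le c hc _
  have hpq : ∀ x, |Qsold c (x - a)| ≤ Real.sqrt c * Qsol c (x - a) := fun x => Qsold_abs_le c hc _
  have hqi := Qsol_shift_integrable c hc a
  have hqc : Continuous fun x => Qsol c (x - a) := by fun_prop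
  have hpc : Continuous fun x => Qsold c (x - a) := by fun_prop
  have hev : Qsol c (0 - a) = Qsol c a := by rw [zero_sub, hea]
  have hod : Qsold c (0 - a) = -Qsold c a := by rw [zero_sub, hoa]
  rw [hea] at hz0
  generalize hq : (fun x => Qsol c (x - a)) = q at *
  generalize hp : (fun x => Qsold c (x - a)) = p at *
  have hq' : ∀ x, Qsol c (x - a) = q x := fun x => by rw [← hq]
  have hp' : ∀ x, Qsold c (x - a) = p x := fun x => by rw [← hp]
  simp only [hq', hp'] at *
  set B := 3 * c / 2 with hB
  have hB0 : 0 ≤ B := by positivity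
  have hr := Real.sqrt_nonneg c
  have hs : Real.sqrt c ^ 2 = c := Real.sq_sqrt hc.le
  have i_q2 : IntegrableOn (fun x => q x ^ 2) (Ioi 0) := by
    refine dom_integrable B hqi (by fun_prop) fun x _ => ?_
    rw [abs_of_nonneg (by positivity)]
    nlinarith [hq0 x, hqB x]
  have i_q3 : IntegrableOn (fun x => q x ^ 3) (Ioi 0) := by
    refine dom_integrable B i_q2 (by fun_prop) fun x _ => ?_
    have := hq0 x
    rw [abs_of_nonneg (by positivity), pow_succ, mul_comm]
    gcongr
    exact hqB x
  have i_p2 : IntegrableOn (fun x => p x ^ 2) (Ioi 0) := by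
    refine dom_integrable c i_q2 (by fun_prop) fun x _ => ?_
    rw [abs_of_nonneg (by positivity), ← sq_abs]
    refine le_trans ?_ (le_of_eq (show (Real.sqrt c * q x) ^ 2 = c * q x ^ 2 by rw [mul_pow, hs]))
    exact pow_le_pow_left₀ (abs_nonneg _) (hpq x) 2
  have i_qz : IntegrableOn (fun x => q x * z x) (Ioi 0) := by
    refine dom_integrable M hqi (by fun_prop) fun x hx => ?_
    rw [abs_mul, abs_of_nonneg (hq0 x), mul_comm]
    exact mul_le_mul_of_nonneg_right (hM x hx.le) (hq0 x)
  have i_q2z : IntegrableOn (fun x => q x ^ 2 * z x) (Ioi 0) := by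
    refine dom_integrable M i_q2 (by fun_prop) fun x hx => ?_
    rw [abs_mul, abs_of_nonneg (sq_nonneg (q x)), mul_comm]
    exact mul_le_mul_of_nonneg_right (hM x hx.le) (sq_nonneg _)
  have i_qz2 : IntegrableOn (fun x => q x * z x ^ 2) (Ioi 0) := by
    refine dom_integrable B hz2 (by fun_prop) fun x hx => ?_
    rw [abs_mul, abs_of_nonneg (hq0 x), abs_of_nonneg (sq_nonneg (z x))]
    exact mul_le_mul_of_nonneg_right (hqB x) (sq_nonneg _)
  have i_pz' : IntegrableOn (fun x => p x * deriv z x) (Ioi 0) := by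
    refine dom_integrable 1 (i_p2.add hz'2) (by fun_prop) fun x hx => ?_
    simp only [Pi.add_apply]
    rw [abs_le]
    constructor <;> nlinarith [sq_nonneg (p x + deriv z x), sq_nonneg (p x - deriv z x)]
  -- integration by parts
  have hlim : Tendsto (fun x => p x * z x) atTop (nhds 0) := by
    refine squeeze_zero_norm (a := fun x => Real.sqrt c * B * |z x|) (fun x => ?_) ?_
    · rw [Real.norm_eq_abs, abs_mul]
      refine mul_le_mul_of_nonneg_right ((hpq x).trans ?_) (abs_nonneg _)
      exact mul_le_mul_of_nonneg_left (hqB x) hr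
    · simpa using hdecay.abs.const_mul (Real.sqrt c * B)
  have i_F : IntegrableOn (fun x => c * (q x * z x) - q x ^ 2 * z x + p x * deriv z x) (Ioi 0) :=
    ((i_qz.const_mul c).sub i_q2z).add i_pz'
  have hF := integral_Ioi_of_hasDerivAt_of_tendsto' (a := 0) (f := fun x => p x * z x)
    (f' := fun x => c * (q x * z x) - q x ^ 2 * z x + p x * deriv z x)
    (fun x _ => ((hpd x).mul (hzd x)).congr_deriv (by ring)) i_F hlim
  have hp0 : p 0 = -Qsold c a := hod
  simp only [hp0, hz0] at hF
  have i1 : IntegrableOn (fun x => 1 / 2 * (p x + deriv z x) ^ 2 - 1 / 3 * (q x + z x) ^ 3)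
      (Ioi 0) := by
    have := (((i_p2.const_mul (1 / 2)).add i_pz').add (hz'2.const_mul (1 / 2))).sub
      ((((i_q3.const_mul (1 / 3)).add i_q2z).add i_qz2).add (hz3.const_mul (1 / 3)))
    refine this.congr (Eventually.of_forall fun x => ?_)
    simp only [Pi.add_apply, Pi.sub_apply]
    ring
  have i2 : IntegrableOn (fun x => (q x + z x) ^ 2) (Ioi 0) := by
    have := (i_q2.add (i_qz.const_mul 2)).add hz2
    refine this.congr (Eventually.of_forall fun x => ?_)
    simp only [Pi.add_apply]
    ring
  have i3 : IntegrableOn (fun x => 1 / 2 * p x ^ 2 - 1 / 3 * q x ^ 3) (Ioi 0) :=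
    (i_p2.const_mul (1 / 2)).sub (i_q3.const_mul (1 / 3))
  have key : (∫ x in Ioi (0 : ℝ), (1 / 2 * (p x + deriv z x) ^ 2 - 1 / 3 * (q x + z x) ^ 3))
      + (∫ x in Ioi (0 : ℝ), c * (1 / 2) * (q x + z x) ^ 2)
      + (∫ x in Ioi (0 : ℝ), q x * z x ^ 2)
      + (∫ x in Ioi (0 : ℝ), 1 / 3 * z x ^ 3)
      = (∫ x in Ioi (0 : ℝ), (1 / 2 * p x ^ 2 - 1 / 3 * q x ^ 3))
      + (∫ x in Ioi (0 : ℝ), c * (1 / 2) * q x ^ 2)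
      + (∫ x in Ioi (0 : ℝ), (c * (q x * z x) - q x ^ 2 * z x + p x * deriv z x))
      + (∫ x in Ioi (0 : ℝ), c / 2 * z x ^ 2)
      + (∫ x in Ioi (0 : ℝ), 1 / 2 * deriv z x ^ 2) := by
    have j2 := i2.const_mul (c * (1 / 2))
    have j3 := hz3.const_mul (1 / 3)
    have j4 := i_q2.const_mul (c * (1 / 2))
    have j5 := hz2.const_mul (c / 2)
    have j6 := hz'2.const_mul (1 / 2)
    rw [← integral_add' i1 j2, ← integral_add' (i1.add j2) i_qz2,
      ← integral_add' ((i1.add j2).add i_qz2) j3,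
      ← integral_add' i3 j4, ← integral_add' (i3.add j4) i_F,
      ← integral_add' ((i3.add j4).add i_F) j5,
      ← integral_add' (((i3.add j4).add i_F).add j5) j6]
    refine integral_congr_ae (Eventually.of_forall fun x => ?_)
    simp only [Pi.add_apply]
    ring
  rw [hF] at key
  simp only [integral_const_mul] at key
  linarith
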